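/- arXiv:2303.00118 — 2 statements merged into one kernel-verified Lean document; each statement's English description precedes it below -/
import Mathlib

section
/- Let v be a place of K and let x ∈ K satisfy ĥ_v(x) > 0. Then there exists N ∈ ℕ such that for every nonzero polynomial Q ∈ F_q[t] with deg Q ≥ N one has ĥ_v(x) = log|Φ_Q(x)|_v / q^{d·deg Q}. -/
open Polynomial Filter Topology

/-- A family of nonarchimedean places on a field `K`, with absolute values normalized so that
every nonzero `x` satisfies `|x|_v = 1` for all but finitely many places and the product
formula holds. -/
structure PlaceFamily (K : Type) [Field K] where
  Places : Type
  absv : Places → AbsoluteValue K ℝ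
  nonarch : ∀ (v : Places) (x y : K), absv v (x + y) ≤ max (absv v x) (absv v y)
  finite_ne_one : ∀ x : K, x ≠ 0 → {v : Places | absv v x ≠ 1}.Finite
  product_formula : ∀ x : K, x ≠ 0 → ∏ᶠ v : Places, absv v x = 1

/-- A Drinfeld module of generic characteristic over `K`: an `𝔽_q`-algebra homomorphism
`Φ : 𝔽_q[t] → K{τ}`, where an element `Σ b_i τ^i` of the twisted polynomial ring `K{τ}` is
recorded as the additive polynomial `Σ b_i X^{q^i} ∈ K[X]` (composition of polynomials
corresponding to multiplication in `K{τ}`); the coefficient of `τ^0` in `Φ_a` equals `a`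
(via the embedding `𝔽_q[t] → K`), and `Φ_t ≠ t·τ^0`. -/
structure DrinfeldModule (Fq K : Type) [Field Fq] [Fintype Fq] [Field K]
    [Algebra (Polynomial Fq) K] where
  toFun : Polynomial Fq → Polynomial K
  map_add' : ∀ a b : Polynomial Fq, toFun (a + b) = toFun a + toFun b
  map_mul' : ∀ a b : Polynomial Fq, toFun (a * b) = (toFun a).comp (toFun b)
  map_C' : ∀ c : Fq, toFun (Polynomial.C c) =
    Polynomial.C (algebraMap (Polynomial Fq) K (Polynomial.C c)) * Polynomial.X
  coeff_one' : ∀ a : Polynomial Fq, (toFun a).coeff 1 = algebraMap (Polynomial Fq) K a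
  support_pow' : ∀ (a : Polynomial Fq) (n : ℕ), (toFun a).coeff n ≠ 0 →
    ∃ i : ℕ, n = (Fintype.card Fq) ^ i
  generic' : toFun Polynomial.X ≠
    Polynomial.C (algebraMap (Polynomial Fq) K Polynomial.X) * Polynomial.X

namespace DrinfeldModule

variable {Fq K : Type} [Field Fq] [Fintype Fq] [Field K] [Algebra (Polynomial Fq) K]

/-- The action `Φ_a(x)` of `a ∈ 𝔽_q[t]` on `x ∈ 𝔾_a(K)` induced by the Drinfeld module. -/
noncomputable def act (Φ : DrinfeldModule Fq K) (a : Polynomial Fq) (x : K) : K :=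
  (Φ.toFun a).eval x

/-- `Φ` has rank `d ≥ 1`, i.e. `Φ_t = Σ_{i=0}^d a_i τ^i` with `a_d ≠ 0`. -/
def HasRank (Φ : DrinfeldModule Fq K) (d : ℕ) : Prop :=
  1 ≤ d ∧ (Φ.toFun Polynomial.X).natDegree = (Fintype.card Fq) ^ d

/-- `x` is a torsion point for `Φ`. -/
def IsTorsion (Φ : DrinfeldModule Fq K) (x : K) : Prop :=
  ∃ Q : Polynomial Fq, Q ≠ 0 ∧ Φ.act Q x = 0

/-- `hv` is the local canonical height attached to `Φ` (of rank `d`) at the place `v`: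
`ĥ_v(x) = lim_{n→∞} log max(|Φ_{t^n}(x)|_v, 1) / q^{nd}`. -/
def IsLocalHeight (Φ : DrinfeldModule Fq K) (d : ℕ) (v : AbsoluteValue K ℝ)
    (hv : K → ℝ) : Prop :=
  ∀ x : K, Tendsto
    (fun n : ℕ => Real.log (max (v (Φ.act (Polynomial.X ^ n) x)) 1) /
      (Fintype.card Fq : ℝ) ^ (n * d)) atTop (𝓝 (hv x))

end DrinfeldModule

/-- The Weil height `h(x) = Σ_v log max(|x|_v, 1)`. -/
noncomputable def weilHeight {K : Type} [Field K] (P : PlaceFamily K) (x : K) : ℝ :=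
  ∑ᶠ v : P.Places, Real.log (max (P.absv v x) 1)

/-- `hh` is the (global) canonical height attached to `Φ` of rank `d`:
`ĥ(x) = lim_{n→∞} h(Φ_{t^n}(x)) / q^{nd}`. -/
def DrinfeldModule.IsCanonicalHeight {Fq K : Type} [Field Fq] [Fintype Fq] [Field K]
    [Algebra (Polynomial Fq) K] (Φ : DrinfeldModule Fq K) (P : PlaceFamily K)
    (d : ℕ) (hh : K → ℝ) : Prop :=
  ∀ x : K, Tendsto
    (fun n : ℕ => weilHeight P (Φ.act (Polynomial.X ^ n) x) /
      (Fintype.card Fq : ℝ) ^ (n * d)) atTop (𝓝 (hh x))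

/-- `β` is `S`-integral with respect to `α`. -/
def SIntegral {K : Type} [Field K] (P : PlaceFamily K) (S : Set P.Places) (α β : K) : Prop :=
  ∀ v : P.Places, v ∉ S →
    (P.absv v α ≤ 1 → 1 ≤ P.absv v (α - β)) ∧
    (1 < P.absv v α → P.absv v β ≤ 1)

/-- `Γ` is a finitely generated `Φ`-submodule: it is generated, as an `A`-module under the
action `a · x = Φ_a(x)`, by finitely many elements. -/
def DrinfeldModule.FinGen {Fq K : Type} [Field Fq] [Fintype Fq] [Field K]
    [Algebra (Polynomial Fq) K] (Φ : DrinfeldModule Fq K) (Γ : AddSubgroup K) : Prop :=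
  ∃ s : Finset K, ∀ x : K, x ∈ Γ ↔ ∃ c : K → Polynomial Fq, x = ∑ g ∈ s, Φ.act (c g) g

open scoped Classical in
/-- `q^{d·deg P}`, with the convention that it equals `0` for the zero polynomial. -/
noncomputable def qdeg {Fq : Type} [Field Fq] [Fintype Fq] (d : ℕ) (P : Polynomial Fq) : ℝ :=
  if P = 0 then 0 else (Fintype.card Fq : ℝ) ^ (d * P.natDegree)

namespace DrinfeldModule

variable {Fq K : Type} [Field Fq] [Fintype Fq] [Field K] [Algebra (Polynomial Fq) K]

lemma act_add (Φ : DrinfeldModule Fq K) (a b : Polynomial Fq) (x : K) :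
    Φ.act (a + b) x = Φ.act a x + Φ.act b x := by
  simp [act, Φ.map_add']

lemma act_mul (Φ : DrinfeldModule Fq K) (a b : Polynomial Fq) (x : K) :
    Φ.act (a * b) x = Φ.act a (Φ.act b x) := by
  simp [act, Φ.map_mul', eval_comp]

lemma act_C (Φ : DrinfeldModule Fq K) (c : Fq) (x : K) :
    Φ.act (C c) x = algebraMap (Polynomial Fq) K (C c) * x := by
  simp [act, Φ.map_C']

lemma act_sum (Φ : DrinfeldModule Fq K) (s : Finset ℕ) (f : ℕ → Polynomial Fq) (x : K) :
    Φ.act (∑ i ∈ s, f i) x = ∑ i ∈ s, Φ.act (f i) x :=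
  map_sum (AddMonoidHom.mk' (fun a => Φ.act a x) fun a b => Φ.act_add a b x) f s

/-- Nonzero constants have absolute value one. -/
lemma absv_algebraMap_C (v : AbsoluteValue K ℝ) {c : Fq} (hc : c ≠ 0) :
    v (algebraMap (Polynomial Fq) K (C c)) = 1 := by
  have h : v (algebraMap (Polynomial Fq) K (C c)) ^ (Fintype.card Fq - 1) = 1 := by
    rw [← map_pow, ← map_pow, ← map_pow, FiniteField.pow_card_sub_one_eq_one c hc]
    simp
  have hq : Fintype.card Fq - 1 ≠ 0 := by
    have := Fintype.one_lt_card (α := Fq)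
    omega
  exact (pow_eq_one_iff_of_nonneg (v.nonneg _) hq).1 h

end DrinfeldModule

lemma absv_sum_lt {K : Type} [Field K] {v : AbsoluteValue K ℝ} (hv : IsNonarchimedean v)
    {B : ℝ} (hB : 0 < B) (s : Finset ℕ) (f : ℕ → K) (h : ∀ i ∈ s, v (f i) < B) :
    v (∑ i ∈ s, f i) < B := by
  induction s using Finset.induction_on with
  | empty => simpa using hB
  | insert a s ha ih =>
    rw [Finset.sum_insert ha]
    exact (hv _ _).trans_lt (max_lt (h a (by simp)) (ih fun i hi => h i (by simp [hi])))

lemma absv_add_eq_left {K : Type} [Field K] {v : AbsoluteValue K ℝ} (hv : IsNonarchimedean v)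
    {a b : K} (h : v b < v a) : v (a + b) = v a := by
  refine le_antisymm ((hv a b).trans (max_le le_rfl h.le)) ?_
  have h2 := hv (a + b) (-b)
  rw [add_neg_cancel_right, v.map_neg] at h2
  exact (le_max_iff.1 h2).resolve_right (not_le.2 h)

/-- Far from the origin a monic polynomial grows exactly like its leading term. -/
lemma exists_absv_eval_eq_pow {K : Type} [Field K] {v : AbsoluteValue K ℝ}
    (hv : IsNonarchimedean v) {f : Polynomial K} (hf : f.Monic) :
    ∃ M : ℝ, 1 ≤ M ∧ ∀ y : K, M < v y → v (f.eval y) = v y ^ f.natDegree := by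
  refine ⟨1 + ∑ i ∈ Finset.range f.natDegree, v (f.coeff i),
    le_add_of_nonneg_right (Finset.sum_nonneg fun i _ => v.nonneg _), fun y hy => ?_⟩
  have hS := Finset.sum_nonneg (s := Finset.range f.natDegree) fun i _ => v.nonneg (f.coeff i)
  have hy1 : 1 < v y := by linarith
  conv_lhs => rw [hf.as_sum]
  simp only [eval_add, eval_pow, eval_X, eval_finsetSum, eval_mul, eval_C]
  rw [absv_add_eq_left hv, map_pow]
  rw [map_pow]
  refine absv_sum_lt hv (by positivity) _ _ fun i hi => ?_
  have hc : v (f.coeff i) < v y := by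
    have := Finset.single_le_sum (fun i _ => v.nonneg (f.coeff i)) hi
    linarith
  calc v (f.coeff i * y ^ i) = v (f.coeff i) * v y ^ i := by simp
    _ < v y * v y ^ i := by gcongr
    _ = v y ^ (i + 1) := (pow_succ' _ _).symm
    _ ≤ v y ^ f.natDegree := pow_le_pow_right₀ hy1.le (Finset.mem_range.1 hi)

/-- If the local height of `x` is positive, the orbit of `x` is unbounded. -/
lemma DrinfeldModule.IsLocalHeight.exists_lt_absv_act {Fq K : Type} [Field Fq] [Fintype Fq]
    [Field K] [Algebra (Polynomial Fq) K] {Φ : DrinfeldModule Fq K} {d : ℕ} (hd : 1 ≤ d)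
    {v : AbsoluteValue K ℝ} {hv : K → ℝ} (hloc : Φ.IsLocalHeight d v hv) {x : K}
    (hx : 0 < hv x) (M : ℝ) : ∃ n : ℕ, M < v (Φ.act (Polynomial.X ^ n) x) := by
  by_contra! hM
  have hq : (1 : ℝ) < Fintype.card Fq := by exact_mod_cast Fintype.one_lt_card
  have h1 : Tendsto (fun n : ℕ => (Fintype.card Fq : ℝ) ^ (n * d)) atTop atTop :=
    (tendsto_pow_atTop_atTop_of_one_lt hq).comp (tendsto_id.atTop_mul_const' (by omega))
  have h2 : Tendsto (fun n : ℕ => Real.log (max M 1) / (Fintype.card Fq : ℝ) ^ (n * d))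
      atTop (𝓝 0) := tendsto_const_nhds.div_atTop h1
  refine hx.not_ge (le_of_tendsto_of_tendsto' (hloc x) h2 fun n => ?_)
  have := hM n
  gcongr

/-- **Lemma.** Let `v` be a place of `K` and let `x ∈ K` satisfy `ĥ_v(x) > 0`. Then there
exists `N ∈ ℕ` such that for every nonzero polynomial `Q ∈ 𝔽_q[t]` with `deg Q ≥ N` one has
`ĥ_v(x) = log|Φ_Q(x)|_v / q^{d·deg Q}`. -/
theorem local_height_eventually_exact
    {Fq K : Type} [Field Fq] [Fintype Fq] [Field K]
    [Algebra (Polynomial Fq) K] [Algebra (RatFunc Fq) K]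
    [IsScalarTower (Polynomial Fq) (RatFunc Fq) K] [FiniteDimensional (RatFunc Fq) K]
    (Φ : DrinfeldModule Fq K) (d : ℕ) (hrank : Φ.HasRank d)
    (hmonic : (Φ.toFun Polynomial.X).Monic)
    (v : AbsoluteValue K ℝ) (hnonarch : ∀ x y : K, v (x + y) ≤ max (v x) (v y))
    (hv : K → ℝ) (hloc : Φ.IsLocalHeight d v hv)
    (x : K) (hx : 0 < hv x) :
    ∃ N : ℕ, ∀ Q : Polynomial Fq, Q ≠ 0 → N ≤ Q.natDegree →
      hv x = Real.log (v (Φ.act Q x)) / (Fintype.card Fq : ℝ) ^ (d * Q.natDegree) := by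
  obtain ⟨hd, hdeg⟩ := hrank
  have hq : 1 < Fintype.card Fq := Fintype.one_lt_card
  obtain ⟨M, hM1, hM⟩ := exists_absv_eval_eq_pow hnonarch hmonic
  have hex := hloc.exists_lt_absv_act hd hx M
  set y : ℕ → K := fun n => Φ.act (Polynomial.X ^ n) x with hy
  set D : ℕ := Fintype.card Fq ^ d with hD
  have hD1 : 1 < D := Nat.one_lt_pow (by omega) hq
  set N := Nat.find hex
  have hyN : M < v (y N) := Nat.find_spec hex
  have hyN1 : 1 < v (y N) := hM1.trans_lt hyN
  have hiter : ∀ k, v (y (N + k)) = v (y N) ^ D ^ k := by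
    intro k
    induction k with
    | zero => simp
    | succ k ih =>
      have hstep : y (N + (k + 1)) = (Φ.toFun Polynomial.X).eval (y (N + k)) := by
        simp only [hy, ← add_assoc, pow_succ' _ (N + k), Φ.act_mul]
        rfl
      have hle : v (y N) ≤ v (y (N + k)) := by
        rw [ih]
        exact le_self_pow₀ hyN1.le (pow_ne_zero _ (by omega))
      rw [hstep, hM _ (hyN.trans_le hle), hdeg, ih, ← pow_mul, ← pow_succ]
  have hlt : ∀ m, N ≤ m → ∀ i < m, v (y i) < v (y m) := by
    intro m hm i hi
    obtain ⟨k, rfl⟩ := Nat.exists_eq_add_of_le hm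
    rcases lt_or_ge i N with h | h
    · rw [hiter]
      calc v (y i) ≤ M := not_lt.1 (Nat.find_min hex h)
        _ < v (y N) := hyN
        _ ≤ v (y N) ^ D ^ k := le_self_pow₀ hyN1.le (pow_ne_zero _ (by omega))
    · obtain ⟨j, rfl⟩ := Nat.exists_eq_add_of_le h
      rw [hiter, hiter]
      exact pow_lt_pow_right₀ hyN1 (Nat.pow_lt_pow_right hD1 (by omega))
  have hlog : ∀ m, N ≤ m → Real.log (v (y m)) / (Fintype.card Fq : ℝ) ^ (d * m) =
      Real.log (v (y N)) / (Fintype.card Fq : ℝ) ^ (d * N) := by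
    intro m hm
    obtain ⟨k, rfl⟩ := Nat.exists_eq_add_of_le hm
    have hq0 : (Fintype.card Fq : ℝ) ≠ 0 := by exact_mod_cast (by omega)
    rw [hiter, Real.log_pow, hD, mul_add, pow_add]
    push_cast
    rw [← pow_mul, mul_comm, mul_div_mul_right _ _ (pow_ne_zero _ hq0)]
  have hheight : hv x = Real.log (v (y N)) / (Fintype.card Fq : ℝ) ^ (d * N) := by
    refine tendsto_nhds_unique (hloc x) (tendsto_const_nhds.congr' ?_)
    filter_upwards [eventually_ge_atTop N] with m hm
    have h1 : 1 ≤ v (y m) := by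
      rcases hm.eq_or_lt with rfl | h
      · exact hyN1.le
      · exact (hyN1.trans (hlt m hm N h)).le
    rw [max_eq_left h1, mul_comm m d]
    exact (hlog m hm).symm
  refine ⟨N, fun Q hQ hm => ?_⟩
  have hmono : ∀ i, Φ.act (C (Q.coeff i) * Polynomial.X ^ i) x =
      algebraMap (Polynomial Fq) K (C (Q.coeff i)) * y i := fun i => by
    rw [Φ.act_mul, Φ.act_C]
  have hypos : 0 < v (y Q.natDegree) := by
    obtain ⟨k, hk⟩ := Nat.exists_eq_add_of_le hm
    rw [hk, hiter]
    positivity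
  have hlead : v (algebraMap (Polynomial Fq) K (C (Q.coeff Q.natDegree)) * y Q.natDegree) =
      v (y Q.natDegree) := by
    rw [map_mul, DrinfeldModule.absv_algebraMap_C v (by simpa using hQ), one_mul]
  have hact : v (Φ.act Q x) = v (y Q.natDegree) := by
    conv_lhs => rw [Q.as_sum_range_C_mul_X_pow]
    rw [Φ.act_sum, Finset.sum_range_succ, add_comm, hmono, absv_add_eq_left hnonarch, hlead]
    rw [hlead]
    refine absv_sum_lt hnonarch hypos _ _ fun i hi => ?_
    rw [hmono, map_mul]
    by_cases hc : Q.coeff i = 0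
    · simpa [hc] using hypos
    · rw [DrinfeldModule.absv_algebraMap_C v hc, one_mul]
      exact hlt _ hm i (Finset.mem_range.1 hi)
  rw [hact, hlog _ hm, hheight]
end

section
/- Let K = F_q(θ) be the rational function field, let Φ be the Drinfeld module of special characteristic over K determined by Φ_t = τ (so Φ_{t^n}(x) = x^{q^n} for all n ≥ 0), and let S be the finite set of places v of K with |θ|_v ≠ 1. Then the elements Φ_{t^n}(θ + 1) = (θ + 1)^{q^n}, for n ≥ 0, are pairwise distinct and each is S-integral with respect to 1. In particular, the cyclic Φ-module generated by θ + 1 contains infinitely many elements that are S-integral with respect to 1, so the conclusion of Siegel's theorem fails for this Drinfeld module of special characteristic. -/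
open Polynomial Filter Topology

/-- Raising to the power `q ^ n` is additive on the rational function field over `𝔽_q`. -/
theorem ratFunc_add_pow_card_pow {Fq : Type} [Field Fq] [Fintype Fq] (x y : RatFunc Fq) (n : ℕ) :
    (x + y) ^ (Fintype.card Fq ^ n) =
      x ^ (Fintype.card Fq ^ n) + y ^ (Fintype.card Fq ^ n) := by
  obtain ⟨p, hp⟩ := CharP.exists Fq
  obtain ⟨k, hprime, hk⟩ := FiniteField.card Fq p
  have : Fact p.Prime := ⟨hprime⟩
  have : CharP (RatFunc Fq) p :=
    charP_of_injective_algebraMap (algebraMap Fq (RatFunc Fq)).injective p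
  rw [hk, ← pow_mul]
  exact add_pow_char_pow x y p _

theorem ratFunc_X_add_one_pow_injective (F : Type) [Field F] :
    Function.Injective (fun m : ℕ => (RatFunc.X + 1 : RatFunc F) ^ m) := by
  intro a b hab
  have h : (X + C 1 : F[X]) ^ a = (X + C 1) ^ b := by
    apply RatFunc.algebraMap_injective F
    simpa using hab
  simpa [natDegree_pow, -map_one, natDegree_X_add_C] using congrArg natDegree h

/-- **Example (failure of Siegel's theorem in special characteristic).** Let `K = 𝔽_q(θ)`,
let `Φ` be the Drinfeld module of special characteristic over `K` with `Φ_t = τ`, so that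
`Φ_{t^n}(x) = x^{q^n}`, and let `S` be the finite set of places `v` of `K` with
`|θ|_v ≠ 1`. Then the elements `Φ_{t^n}(θ+1) = (θ+1)^{q^n}` are pairwise distinct and each
is `S`-integral with respect to `1`; in particular the cyclic `Φ`-module generated by
`θ + 1` contains infinitely many elements that are `S`-integral with respect to `1`. -/
theorem special_characteristic_counterexample
    {Fq : Type} [Field Fq] [Fintype Fq]
    (P : PlaceFamily (RatFunc Fq))
    (S : Set P.Places) (hS : S = {v : P.Places | P.absv v RatFunc.X ≠ 1}) :
    S.Finite ∧
    Function.Injective (fun n : ℕ =>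
      (RatFunc.X + 1 : RatFunc Fq) ^ ((Fintype.card Fq) ^ n)) ∧
    (∀ n : ℕ, SIntegral P S (1 : RatFunc Fq)
      ((RatFunc.X + 1) ^ ((Fintype.card Fq) ^ n))) ∧
    {β : RatFunc Fq | ∃ n : ℕ, β = (RatFunc.X + 1) ^ ((Fintype.card Fq) ^ n)}.Infinite := by
  have hinj : Function.Injective (fun n : ℕ =>
      (RatFunc.X + 1 : RatFunc Fq) ^ ((Fintype.card Fq) ^ n)) :=
    (ratFunc_X_add_one_pow_injective Fq).comp (Nat.pow_right_injective Fintype.one_lt_card)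
  refine ⟨hS ▸ P.finite_ne_one _ RatFunc.X_ne_zero, hinj, fun n v hv => ?_, ?_⟩
  · have hX : P.absv v RatFunc.X = 1 := by simpa [hS] using hv
    refine ⟨fun _ => ?_, fun h => absurd h (by simp)⟩
    rw [ratFunc_add_pow_card_pow, one_pow, sub_add_cancel_right, AbsoluteValue.map_neg,
      map_pow, hX, one_pow]
  · convert Set.infinite_range_of_injective hinj using 1
    ext β
    simp [eq_comm]
end
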